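/- Fix integers d ≥ 1 and N ≥ 1. For unitaries U_1, …, U_N ∈ U(d), an outcome string x = (x_1, …, x_N) ∈ (Fin d)^N, define Z(U, x) = ∫ ∏_{i=1}^N |⟨U_i e_{x_i}, φ⟩|² dμ_d(φ) (which is strictly positive). Then the Haar-averaged posterior-mean fidelity satisfies: ∫_{U(d)} ⋯ ∫_{U(d)} Σ_{x ∈ (Fin d)^N} ∫ |⟨U_N e_{x_N}, ψ⟩|² · Z(U, x)⁻¹ · ( ∫ |⟨ψ, φ⟩|² ∏_{i=1}^N |⟨U_i e_{x_i}, φ⟩|² dμ_d(φ) ) dμ_d(ψ) dU_1 ⋯ dU_N ≥ (d+3)·(N+d−1)! / (d^N · (d+1)² · N! · (d−1)!). Equivalently, the average risk (measured in infidelity) of the Bayesian mean estimator after N measurements in independent Haar-random orthonormal bases, averaged over the Haar ensemble of pure states, is at most 1 − (d+3)(N+d−1)!/(d^N (d+1)² N! (d−1)!). -/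

import Mathlib

open MeasureTheory Matrix

/-- The Hermitian inner product `⟨u, v⟩ = ∑ i, conj (u i) * v i` on `ℂ^d`. -/
noncomputable def cInner {d : ℕ} (u v : Fin d → ℂ) : ℂ :=
  ∑ i, (starRingEnd ℂ) (u i) * v i

/-- `μ` is the Haar probability measure on the compact group `U(d)` of `d × d`
complex unitary matrices, viewed as a Borel measure on the space of all `d × d`
complex matrices: it is a probability measure, it is supported on the unitary
matrices, and it is invariant under left translation by every unitary matrix.
(On the compact metrizable group `U(d)` these properties characterize the Haar
probability measure uniquely.) -/
def IsHaarUnitary {d : ℕ} (μ : Measure (Fin d → Fin d → ℂ)) : Prop :=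
  IsProbabilityMeasure μ ∧
    (∀ᵐ U ∂μ, Matrix.of U ∈ Matrix.unitaryGroup (Fin d) ℂ) ∧
    ∀ V ∈ Matrix.unitaryGroup (Fin d) ℂ,
      μ.map (fun U => Matrix.of.symm (V * Matrix.of U)) = μ

/-- The Haar pure-state measure `μ_d` on `ℂ^d`: the pushforward of the Haar
probability measure on `U(d)` under the map sending a unitary to its first
column. -/
noncomputable def pureStateMeasure {d : ℕ} (hd : 0 < d)
    (μ : Measure (Fin d → Fin d → ℂ)) : Measure (Fin d → ℂ) :=
  μ.map fun U i => U i ⟨0, hd⟩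

/-- The Born-rule probability `|⟨U e_x, ψ⟩|²` of outcome `x` when measuring the
pure state `ψ` in the orthonormal basis given by the columns of `U`. -/
noncomputable def bornP {d : ℕ} (U : Fin d → Fin d → ℂ) (x : Fin d)
    (ψ : Fin d → ℂ) : ℝ :=
  ‖∑ i, (starRingEnd ℂ) (U i x) * ψ i‖ ^ 2

/-- The normalization constant `Z(U, x) = ∫ ∏ᵢ |⟨Uᵢ e_{xᵢ}, φ⟩|² dμ_d(φ)` of the
Bayesian posterior after observing outcomes `x₁, …, x_N` in the Haar-random
bases given by the columns of `U₁, …, U_N`, starting from the Haar prior. -/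
noncomputable def bayesZ {d N : ℕ} (hd : 0 < d)
    (μU : Measure (Fin d → Fin d → ℂ)) (U : Fin N → Fin d → Fin d → ℂ)
    (x : Fin N → Fin d) : ℝ :=
  ∫ φ, ∏ i, bornP (U i) (x i) φ ∂(pureStateMeasure hd μU)


/-- A probability measure on the unit vectors of `ℂ^d` that is invariant under the unitary group. -/
structure IsUnitarilyInvariant {d : ℕ} (ν : Measure (Fin d → ℂ)) : Prop where
  isProbabilityMeasure : IsProbabilityMeasure ν
  ae_unit : ∀ᵐ ψ ∂ν, ∑ i, ‖ψ i‖ ^ 2 = 1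
  map_mulVec : ∀ V ∈ Matrix.unitaryGroup (Fin d) ℂ, ν.map (fun ψ => V *ᵥ ψ) = ν

theorem cInner_eq_inner {d : ℕ} (u v : Fin d → ℂ) :
    cInner u v = inner ℂ (WithLp.toLp 2 u : EuclideanSpace ℂ (Fin d)) (WithLp.toLp 2 v) := by
  simp [cInner, PiLp.inner_apply, mul_comm]

theorem norm_cInner_comm {d : ℕ} (u v : Fin d → ℂ) : ‖cInner u v‖ = ‖cInner v u‖ := by
  rw [cInner_eq_inner, cInner_eq_inner, norm_inner_symm]

theorem norm_toLp_sq {d : ℕ} (u : Fin d → ℂ) :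
    ‖(WithLp.toLp 2 u : EuclideanSpace ℂ (Fin d))‖ ^ 2 = ∑ i, ‖u i‖ ^ 2 := by
  simp [EuclideanSpace.norm_sq_eq]

theorem norm_cInner_sq_le {d : ℕ} (u v : Fin d → ℂ) :
    ‖cInner u v‖ ^ 2 ≤ (∑ i, ‖u i‖ ^ 2) * ∑ i, ‖v i‖ ^ 2 := by
  rw [cInner_eq_inner, ← norm_toLp_sq, ← norm_toLp_sq, ← mul_pow]
  gcongr
  exact norm_inner_le_norm _ _

theorem continuous_cInner {d : ℕ} :
    Continuous fun q : (Fin d → ℂ) × (Fin d → ℂ) => cInner q.1 q.2 := by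
  unfold cInner
  fun_prop

theorem bornP_nonneg {d : ℕ} (U : Fin d → Fin d → ℂ) (x : Fin d) (ψ : Fin d → ℂ) :
    0 ≤ bornP U x ψ := by
  unfold bornP
  positivity

theorem bornP_eq_cInner {d : ℕ} (U : Fin d → Fin d → ℂ) (x : Fin d) (ψ : Fin d → ℂ) :
    bornP U x ψ = ‖cInner (fun i => U i x) ψ‖ ^ 2 := rfl

theorem sum_norm_sq_mulVec {d : ℕ} {V : Matrix (Fin d) (Fin d) ℂ}
    (hV : V ∈ Matrix.unitaryGroup (Fin d) ℂ) (ψ : Fin d → ℂ) :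
    ∑ i, ‖(V *ᵥ ψ) i‖ ^ 2 = ∑ i, ‖ψ i‖ ^ 2 := by
  have key : ∀ φ : Fin d → ℂ, ((∑ i, ‖φ i‖ ^ 2 : ℝ) : ℂ) = star φ ⬝ᵥ φ := by
    intro φ
    simp only [dotProduct, Pi.star_apply, Complex.ofReal_sum, Complex.ofReal_pow]
    refine Finset.sum_congr rfl fun i _ => ?_
    exact (Complex.conj_mul' (φ i)).symm
  apply Complex.ofReal_injective
  rw [key, key, star_mulVec, dotProduct_mulVec, vecMul_vecMul, ← star_eq_conjTranspose,
    Matrix.mem_unitaryGroup_iff'.mp hV, vecMul_one]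

theorem sum_norm_sq_col {d : ℕ} {U : Fin d → Fin d → ℂ}
    (hU : Matrix.of U ∈ Matrix.unitaryGroup (Fin d) ℂ) (x : Fin d) :
    ∑ i, ‖U i x‖ ^ 2 = 1 := by
  have h := sum_norm_sq_mulVec hU (Pi.single x 1)
  simp only [mulVec_single_one] at h
  simpa [Matrix.col_apply, Pi.single_apply, apply_ite (fun z : ℂ => ‖z‖ ^ 2)] using h

theorem sum_bornP {d : ℕ} {U : Fin d → Fin d → ℂ}
    (hU : Matrix.of U ∈ Matrix.unitaryGroup (Fin d) ℂ) (ψ : Fin d → ℂ) :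
    ∑ x, bornP U x ψ = ∑ i, ‖ψ i‖ ^ 2 := by
  have h : star (Matrix.of U) ∈ Matrix.unitaryGroup (Fin d) ℂ := Unitary.star_mem hU
  rw [← sum_norm_sq_mulVec h ψ]
  rfl

theorem isUnitarilyInvariant_pureStateMeasure {d : ℕ} (hd : 0 < d)
    {μ : Measure (Fin d → Fin d → ℂ)} (hμ : IsHaarUnitary μ) :
    IsUnitarilyInvariant (pureStateMeasure hd μ) := by
  obtain ⟨hp, hu, hi⟩ := hμ
  have hm : Measurable fun (U : Fin d → Fin d → ℂ) i => U i ⟨0, hd⟩ := by fun_prop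
  refine ⟨Measure.isProbabilityMeasure_map hm.aemeasurable, ?_, fun V hV => ?_⟩
  · rw [pureStateMeasure, ae_map_iff hm.aemeasurable]
    · filter_upwards [hu] with U hU using sum_norm_sq_col hU _
    · exact (isClosed_eq (by fun_prop) continuous_const).measurableSet
  · have hV1 : Measurable fun ψ : Fin d → ℂ => V *ᵥ ψ :=
      (Continuous.matrix_mulVec continuous_const continuous_id).measurable
    have hV2 : Measurable fun U : Fin d → Fin d → ℂ => Matrix.of.symm (V * Matrix.of U) := by
      refine Continuous.measurable ?_
      exact Continuous.matrix_mul (A := fun _ : Fin d → Fin d → ℂ => V)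
        (B := fun U => Matrix.of U) continuous_const continuous_id
    rw [pureStateMeasure, Measure.map_map hV1 hm]
    conv_rhs => rw [← hi V hV, Measure.map_map hm hV2]
    rfl

theorem isCompact_unit_vectors (d : ℕ) :
    IsCompact {ψ : Fin d → ℂ | ∑ i, ‖ψ i‖ ^ 2 = 1} := by
  refine Metric.isCompact_of_isClosed_isBounded
    (isClosed_eq (by fun_prop) continuous_const) ?_
  refine (Metric.isBounded_closedBall (x := (0 : Fin d → ℂ)) (r := 1)).subset fun ψ hψ => ?_
  rw [mem_closedBall_zero_iff, pi_norm_le_iff_of_nonneg zero_le_one]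
  intro i
  have h : ‖ψ i‖ ^ 2 ≤ 1 := by
    rw [← (show ∑ i, ‖ψ i‖ ^ 2 = 1 from hψ)]
    exact Finset.single_le_sum (f := fun i => ‖ψ i‖ ^ 2) (fun _ _ => by positivity)
      (Finset.mem_univ i)
  exact (sq_le_one_iff₀ (norm_nonneg _)).mp h

theorem exists_unitary_mulVec_apply_eq_cInner {d : ℕ} (k : Fin d) {u : Fin d → ℂ}
    (hu : ∑ i, ‖u i‖ ^ 2 = 1) :
    ∃ V ∈ Matrix.unitaryGroup (Fin d) ℂ, ∀ ψ, (V *ᵥ ψ) k = cInner u ψ := by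
  have hn : ‖(WithLp.toLp 2 u : EuclideanSpace ℂ (Fin d))‖ = 1 := by
    rw [← sq_eq_sq₀ (norm_nonneg _) zero_le_one, norm_toLp_sq, hu, one_pow]
  let v : Fin d → EuclideanSpace ℂ (Fin d) := fun _ => WithLp.toLp 2 u
  have hv : Orthonormal ℂ (({k} : Set (Fin d)).domRestrict v) := by
    refine ⟨fun _ => hn, fun i j hij => (hij (Subsingleton.elim i j)).elim⟩
  obtain ⟨b, hb⟩ := hv.exists_orthonormalBasis_extension_of_card_eq
    (by simp)
  have hbu : b k = WithLp.toLp 2 u := hb k rfl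
  refine ⟨b.toBasis.toMatrix (EuclideanSpace.basisFun (Fin d) ℂ),
    b.toMatrix_orthonormalBasis_mem_unitary _, fun ψ => ?_⟩
  simp only [mulVec, dotProduct, Module.Basis.toMatrix_apply, OrthonormalBasis.coe_toBasis_repr_apply,
    OrthonormalBasis.repr_apply_apply, hbu, cInner]
  simp [EuclideanSpace.inner_single_right]

theorem norm_sq_add_four_phases (a b : ℂ) :
    (‖a + b‖ ^ 2) ^ 2 + (‖a - b‖ ^ 2) ^ 2 + (‖a + Complex.I * b‖ ^ 2) ^ 2
      + (‖a - Complex.I * b‖ ^ 2) ^ 2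
      = 4 * (‖a‖ ^ 2) ^ 2 + 4 * (‖b‖ ^ 2) ^ 2 + 16 * (‖a‖ ^ 2 * ‖b‖ ^ 2) := by
  simp only [Complex.sq_norm, Complex.normSq_apply, Complex.add_re, Complex.add_im,
    Complex.sub_re, Complex.sub_im, Complex.mul_re, Complex.mul_im, Complex.I_re, Complex.I_im]
  ring

theorem sum_norm_sq_add_smul {d : ℕ} (u v : Fin d → ℂ) {c : ℂ} (hc : ‖c‖ = 1) :
    ∑ i, ‖(u + c • v) i‖ ^ 2 =
      ∑ i, ‖u i‖ ^ 2 + ∑ i, ‖v i‖ ^ 2 + 2 * (c * cInner u v).re := by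
  rw [← norm_toLp_sq, ← norm_toLp_sq, ← norm_toLp_sq, cInner_eq_inner, WithLp.toLp_add,
    WithLp.toLp_smul, norm_add_sq (𝕜 := ℂ), inner_smul_right, norm_smul, hc, one_mul]
  simp only [RCLike.re_to_complex]
  ring

theorem cInner_add_smul_left {d : ℕ} (u v ψ : Fin d → ℂ) (c : ℂ) :
    cInner (u + c • v) ψ = cInner u ψ + (starRingEnd ℂ) c * cInner v ψ := by
  simp only [cInner, Pi.add_apply, Pi.smul_apply, smul_eq_mul, map_add, map_mul, add_mul,
    Finset.sum_add_distrib, Finset.mul_sum, mul_assoc]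

namespace IsUnitarilyInvariant

variable {d : ℕ} {ν : Measure (Fin d → ℂ)}

theorem integrable_of_continuous (hν : IsUnitarilyInvariant ν) {f : (Fin d → ℂ) → ℝ}
    (hf : Continuous f) : Integrable f ν := by
  have := hν.isProbabilityMeasure
  rw [← Measure.restrict_eq_self_of_ae_mem (μ := ν)
    (s := {ψ : Fin d → ℂ | ∑ i, ‖ψ i‖ ^ 2 = 1}) hν.ae_unit]
  exact hf.continuousOn.integrableOn_compact (isCompact_unit_vectors d)

theorem integrable_prod_of_continuous (hν : IsUnitarilyInvariant ν)
    {f : (Fin d → ℂ) × (Fin d → ℂ) → ℝ} (hf : Continuous f) : Integrable f (ν.prod ν) := by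
  have := hν.isProbabilityMeasure
  rw [← Measure.restrict_eq_self_of_ae_mem (μ := ν.prod ν)
    (s := {ψ | ∑ i, ‖ψ i‖ ^ 2 = 1} ×ˢ {ψ | ∑ i, ‖ψ i‖ ^ 2 = 1})]
  · exact hf.continuousOn.integrableOn_compact
      ((isCompact_unit_vectors d).prod (isCompact_unit_vectors d))
  · filter_upwards [Measure.quasiMeasurePreserving_fst.ae hν.ae_unit,
      Measure.quasiMeasurePreserving_snd.ae hν.ae_unit] with q h1 h2 using ⟨h1, h2⟩

/-- The moments `∫ |⟨u, ψ⟩|^(2n)` depend only on the norm of `u`. -/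
theorem integral_norm_cInner_pow (hν : IsUnitarilyInvariant ν) (k : Fin d) (n : ℕ)
    (u : Fin d → ℂ) :
    ∫ ψ, (‖cInner u ψ‖ ^ 2) ^ n ∂ν = (∑ i, ‖u i‖ ^ 2) ^ n * ∫ ψ, (‖ψ k‖ ^ 2) ^ n ∂ν := by
  have := hν.isProbabilityMeasure
  have unit_case : ∀ u : Fin d → ℂ, ∑ i, ‖u i‖ ^ 2 = 1 →
      ∫ ψ, (‖cInner u ψ‖ ^ 2) ^ n ∂ν = ∫ ψ, (‖ψ k‖ ^ 2) ^ n ∂ν := by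
    intro u hu
    obtain ⟨V, hV, hVu⟩ := exists_unitary_mulVec_apply_eq_cInner k hu
    conv_rhs => rw [← hν.map_mulVec V hV]
    rw [integral_map]
    · simp_rw [hVu]
    · exact (Continuous.matrix_mulVec continuous_const continuous_id).aemeasurable
    · exact Continuous.aestronglyMeasurable (by fun_prop)
  obtain ⟨r, hr0, hr⟩ : ∃ r : ℝ, 0 ≤ r ∧ r ^ 2 = ∑ i, ‖u i‖ ^ 2 :=
    ⟨_, norm_nonneg _, norm_toLp_sq u⟩
  rw [← hr]
  rcases hr0.eq_or_lt with h0 | hpos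
  · have hu : u = 0 := by
      rw [← h0, zero_pow two_ne_zero, eq_comm,
        Finset.sum_eq_zero_iff_of_nonneg (fun _ _ => by positivity)] at hr
      ext i
      simpa using hr i (Finset.mem_univ i)
    rcases n.eq_zero_or_pos with rfl | hn
    · simp
    · simp [hu, ← h0, cInner, hn.ne']
  · have hw : ∑ i, ‖((r : ℂ)⁻¹ • u) i‖ ^ 2 = 1 := by
      simp only [Pi.smul_apply, smul_eq_mul, norm_mul, mul_pow, ← Finset.mul_sum, ← hr, norm_inv,
        Complex.norm_real, Real.norm_eq_abs, sq_abs, inv_pow]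
      exact inv_mul_cancel₀ (by positivity)
    rw [← unit_case _ hw, ← integral_const_mul]
    refine integral_congr_ae (.of_forall fun ψ => ?_)
    have hc : cInner ((r : ℂ)⁻¹ • u) ψ = (r : ℂ)⁻¹ * cInner u ψ := by
      simp [cInner, Finset.mul_sum, mul_assoc]
    simp only [hc, norm_mul, norm_inv, Complex.norm_real, Real.norm_eq_abs, mul_pow, inv_pow,
      sq_abs, ← mul_assoc]
    rw [mul_inv_cancel₀ (by positivity), one_mul]

theorem integral_norm_cInner_sq (hν : IsUnitarilyInvariant ν) (u : Fin d → ℂ) :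
    ∫ ψ, ‖cInner u ψ‖ ^ 2 ∂ν = (∑ i, ‖u i‖ ^ 2) / d := by
  have := hν.isProbabilityMeasure
  rcases d.eq_zero_or_pos with rfl | hd
  · simp [cInner]
  have hc : ∀ k j : Fin d, ∫ ψ, ‖ψ k‖ ^ 2 ∂ν = ∫ ψ, ‖ψ j‖ ^ 2 ∂ν := by
    intro k j
    have h := hν.integral_norm_cInner_pow j 1 (Pi.single k 1)
    simpa [cInner, Pi.single_apply, apply_ite (fun z : ℂ => ‖z‖ ^ 2),
      apply_ite (starRingEnd ℂ)] using h
  have hsum : ∑ k : Fin d, ∫ ψ, ‖ψ k‖ ^ 2 ∂ν = 1 := by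
    rw [← integral_finsetSum _ fun k _ => hν.integrable_of_continuous (by fun_prop),
      integral_congr_ae hν.ae_unit]
    simp
  rw [Finset.sum_congr rfl fun k _ => hc k ⟨0, hd⟩] at hsum
  simp only [Finset.sum_const, Finset.card_univ, Fintype.card_fin, nsmul_eq_mul] at hsum
  have h := hν.integral_norm_cInner_pow ⟨0, hd⟩ 1 u
  simp only [pow_one] at h
  rw [h, eq_inv_of_mul_eq_one_right hsum, div_eq_mul_inv]

theorem integral_norm_cInner_sq_mul_eq (hν : IsUnitarilyInvariant ν) (k : Fin d)
    (u v : Fin d → ℂ) :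
    ∫ ψ, ‖cInner u ψ‖ ^ 2 * ‖cInner v ψ‖ ^ 2 ∂ν =
      ((∑ i, ‖u i‖ ^ 2) * (∑ i, ‖v i‖ ^ 2) + ‖cInner u v‖ ^ 2) / 2 *
        ∫ ψ, (‖ψ k‖ ^ 2) ^ 2 ∂ν := by
  have hcont : ∀ w : Fin d → ℂ, Continuous fun ψ => cInner w ψ := fun w => by
    unfold cInner
    fun_prop
  have hint : ∀ w : Fin d → ℂ, Integrable (fun ψ => (‖cInner w ψ‖ ^ 2) ^ 2) ν := fun w =>
    hν.integrable_of_continuous (by have := hcont w; fun_prop)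
  have hint2 : Integrable (fun ψ => ‖cInner u ψ‖ ^ 2 * ‖cInner v ψ‖ ^ 2) ν :=
    hν.integrable_of_continuous (by have := hcont u; have := hcont v; fun_prop)
  have hsum : ∀ ψ, (‖cInner (u + (1 : ℂ) • v) ψ‖ ^ 2) ^ 2 + (‖cInner (u + (-1 : ℂ) • v) ψ‖ ^ 2) ^ 2
      + (‖cInner (u + (-Complex.I) • v) ψ‖ ^ 2) ^ 2 + (‖cInner (u + Complex.I • v) ψ‖ ^ 2) ^ 2
      = 4 * (‖cInner u ψ‖ ^ 2) ^ 2 + 4 * (‖cInner v ψ‖ ^ 2) ^ 2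
        + 16 * (‖cInner u ψ‖ ^ 2 * ‖cInner v ψ‖ ^ 2) := by
    intro ψ
    simp only [cInner_add_smul_left, ← norm_sq_add_four_phases, map_one, map_neg, Complex.conj_I,
      one_mul, neg_mul, neg_neg, ← sub_eq_add_neg]
  have h := integral_congr_ae (μ := ν) (.of_forall hsum)
  rw [integral_add (((hint _).fun_add (hint _)).fun_add (hint _)) (hint _),
    integral_add ((hint _).fun_add (hint _)) (hint _), integral_add (hint _) (hint _),
    integral_add (((hint _).const_mul _).fun_add ((hint _).const_mul _)) (hint2.const_mul _),
    integral_add ((hint _).const_mul _) ((hint _).const_mul _), integral_const_mul,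
    integral_const_mul, integral_const_mul] at h
  simp only [hν.integral_norm_cInner_pow k 2] at h
  rw [sum_norm_sq_add_smul u v (by simp), sum_norm_sq_add_smul u v (by simp),
    sum_norm_sq_add_smul u v (by simp), sum_norm_sq_add_smul u v (by simp)] at h
  simp only [Complex.mul_re, Complex.one_re, Complex.one_im, Complex.neg_re, Complex.neg_im,
    Complex.I_re, Complex.I_im] at h
  rw [Complex.sq_norm (cInner u v), Complex.normSq_apply]
  linear_combination (-1 / 16) * h

theorem integral_norm_sq_sq (hν : IsUnitarilyInvariant ν) (k : Fin d) :
    ∫ ψ, (‖ψ k‖ ^ 2) ^ 2 ∂ν = 2 / (d * (d + 1)) := by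
  have hd : (0 : ℝ) < d := by exact_mod_cast k.pos
  have hs : ∀ (j : Fin d) (ψ : Fin d → ℂ), cInner (Pi.single j 1) ψ = ψ j := fun j ψ => by
    simp [cInner, Pi.single_apply, apply_ite (starRingEnd ℂ)]
  have hn : ∀ j : Fin d, ∑ i, ‖(Pi.single j 1 : Fin d → ℂ) i‖ ^ 2 = 1 := fun j => by
    simp [Pi.single_apply, apply_ite (fun z : ℂ => ‖z‖ ^ 2)]
  have h1 : ∑ j, ∫ ψ, ‖ψ k‖ ^ 2 * ‖ψ j‖ ^ 2 ∂ν = 1 / d := by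
    have h := hν.integral_norm_cInner_sq (Pi.single k 1)
    simp only [hs, hn] at h
    rw [← integral_finsetSum _ fun j _ => hν.integrable_of_continuous (by fun_prop), ← h]
    refine integral_congr_ae ?_
    filter_upwards [hν.ae_unit] with ψ hψ
    rw [← Finset.mul_sum, hψ, mul_one]
  have h2 : ∀ j, ∫ ψ, ‖ψ k‖ ^ 2 * ‖ψ j‖ ^ 2 ∂ν =
      (1 + if j = k then 1 else 0) / 2 * ∫ ψ, (‖ψ k‖ ^ 2) ^ 2 ∂ν := by
    intro j
    have h := hν.integral_norm_cInner_sq_mul_eq k (Pi.single k 1) (Pi.single j 1)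
    simp only [hs, hn] at h
    rw [h]
    by_cases hjk : j = k
    · simp [hjk]
    · simp [hjk, Ne.symm hjk]
  simp only [h2, ← Finset.sum_mul, ← Finset.sum_div, Finset.sum_add_distrib] at h1
  simp only [Finset.sum_const, Finset.card_univ, Fintype.card_fin, nsmul_eq_mul, mul_one,
    Finset.sum_ite_eq', Finset.mem_univ, if_true] at h1
  field_simp at h1 ⊢
  linear_combination h1

/-- The second moment of a Haar-random pure state. -/
theorem integral_norm_cInner_sq_mul (hν : IsUnitarilyInvariant ν) (hd : 0 < d)
    (u v : Fin d → ℂ) :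
    ∫ ψ, ‖cInner u ψ‖ ^ 2 * ‖cInner v ψ‖ ^ 2 ∂ν =
      ((∑ i, ‖u i‖ ^ 2) * (∑ i, ‖v i‖ ^ 2) + ‖cInner u v‖ ^ 2) / (d * (d + 1)) := by
  rw [hν.integral_norm_cInner_sq_mul_eq ⟨0, hd⟩, hν.integral_norm_sq_sq]
  ring

theorem integral_norm_cInner_sq_mul_integral (hν : IsUnitarilyInvariant ν) (hd : 0 < d)
    {u : Fin d → ℂ} (hu : ∑ i, ‖u i‖ ^ 2 = 1) (c : ℝ) {P : (Fin d → ℂ) → ℝ}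
    (hP : Continuous P) :
    ∫ ψ, ‖cInner u ψ‖ ^ 2 * c * (∫ φ, ‖cInner ψ φ‖ ^ 2 * P φ ∂ν) ∂ν =
      c * (∫ φ, P φ ∂ν + ∫ φ, ‖cInner u φ‖ ^ 2 * P φ ∂ν) / (d * (d + 1)) := by
  have := hν.isProbabilityMeasure
  have hcu : Continuous fun ψ => cInner u ψ := by unfold cInner; fun_prop
  have hc := continuous_cInner (d := d)
  simp_rw [← integral_const_mul]
  rw [integral_integral_swap (hν.integrable_prod_of_continuous (by
    simp only [Function.uncurry_def]
    fun_prop))]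
  rw [← integral_add (hν.integrable_of_continuous hP)
    (hν.integrable_of_continuous (by fun_prop)), ← integral_const_mul, ← integral_div]
  refine integral_congr_ae ?_
  filter_upwards [hν.ae_unit] with φ hφ
  have h := hν.integral_norm_cInner_sq_mul hd u φ
  rw [hu, hφ] at h
  have h' : ∀ ψ, ‖cInner u ψ‖ ^ 2 * c * (‖cInner ψ φ‖ ^ 2 * P φ) =
      (c * P φ) * (‖cInner u ψ‖ ^ 2 * ‖cInner φ ψ‖ ^ 2) := by
    intro ψ
    rw [norm_cInner_comm ψ φ]
    ring
  simp_rw [h', integral_const_mul, h]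
  ring

end IsUnitarilyInvariant

theorem continuous_prod_bornP {d N : ℕ} (U : Fin N → Fin d → Fin d → ℂ) (x : Fin N → Fin d) :
    Continuous fun φ => ∏ i, bornP (U i) (x i) φ := by
  unfold bornP
  fun_prop

theorem bornP_le_one {d : ℕ} {U : Fin d → Fin d → ℂ}
    (hU : Matrix.of U ∈ Matrix.unitaryGroup (Fin d) ℂ) (x : Fin d) {ψ : Fin d → ℂ}
    (hψ : ∑ i, ‖ψ i‖ ^ 2 = 1) : bornP U x ψ ≤ 1 := by
  have h := norm_cInner_sq_le (fun i => U i x) ψ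
  rwa [sum_norm_sq_col hU, hψ, one_mul] at h

/-- The integral `∫ p_k ∏ᵢ pᵢ dν` of the outcome likelihood weighted by the probability of
outcome `x_k`. -/
noncomputable def weightedLikelihood {d N : ℕ} (ν : Measure (Fin d → ℂ))
    (U : Fin N → Fin d → Fin d → ℂ) (x : Fin N → Fin d) (k : Fin N) : ℝ :=
  ∫ φ, bornP (U k) (x k) φ * ∏ i, bornP (U i) (x i) φ ∂ν

/-- The integral `∫ ∏ᵢ pᵢ dν` of the outcome likelihood. -/
noncomputable def meanLikelihood {d N : ℕ} (ν : Measure (Fin d → ℂ))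
    (U : Fin N → Fin d → Fin d → ℂ) (x : Fin N → Fin d) : ℝ :=
  ∫ φ, ∏ i, bornP (U i) (x i) φ ∂ν

section Likelihood

variable {d N : ℕ} {ν : Measure (Fin d → ℂ)} {U : Fin N → Fin d → Fin d → ℂ}

theorem meanLikelihood_nonneg (x : Fin N → Fin d) : 0 ≤ meanLikelihood ν U x :=
  integral_nonneg fun _ => Finset.prod_nonneg fun _ _ => bornP_nonneg _ _ _

theorem weightedLikelihood_nonneg (x : Fin N → Fin d) (k : Fin N) :
    0 ≤ weightedLikelihood ν U x k :=
  integral_nonneg fun _ =>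
    mul_nonneg (bornP_nonneg _ _ _) (Finset.prod_nonneg fun _ _ => bornP_nonneg _ _ _)

theorem weightedLikelihood_le (hν : IsUnitarilyInvariant ν)
    (hU : ∀ i, Matrix.of (U i) ∈ Matrix.unitaryGroup (Fin d) ℂ) (x : Fin N → Fin d)
    (k : Fin N) : weightedLikelihood ν U x k ≤ meanLikelihood ν U x := by
  refine integral_mono_ae (hν.integrable_of_continuous ?_)
    (hν.integrable_of_continuous (continuous_prod_bornP U x)) ?_
  · have := continuous_prod_bornP U x
    unfold bornP at *
    fun_prop
  · filter_upwards [hν.ae_unit] with φ hφ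
    exact mul_le_of_le_one_left (Finset.prod_nonneg fun _ _ => bornP_nonneg _ _ _)
      (bornP_le_one (hU k) (x k) hφ)

theorem sum_meanLikelihood (hν : IsUnitarilyInvariant ν)
    (hU : ∀ i, Matrix.of (U i) ∈ Matrix.unitaryGroup (Fin d) ℂ) :
    ∑ x, meanLikelihood ν U x = 1 := by
  have := hν.isProbabilityMeasure
  unfold meanLikelihood
  rw [← integral_finsetSum _ fun x _ => hν.integrable_of_continuous (continuous_prod_bornP U x)]
  have h : (fun φ => ∑ x : Fin N → Fin d, ∏ i, bornP (U i) (x i) φ) =ᵐ[ν] fun _ => 1 := by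
    filter_upwards [hν.ae_unit] with φ hφ
    rw [← Fintype.piFinset_univ,
      ← Finset.prod_univ_sum (fun _ => Finset.univ) fun i y => bornP (U i) y φ]
    exact Finset.prod_eq_one fun i _ => by rw [sum_bornP (hU i), hφ]
  rw [integral_congr_ae h]
  simp

theorem meanLikelihood_le (hν : IsUnitarilyInvariant ν) (hd : 0 < d)
    (hU : ∀ i, Matrix.of (U i) ∈ Matrix.unitaryGroup (Fin d) ℂ) (x : Fin N → Fin d)
    {j k : Fin N} (hjk : j ≠ k) : meanLikelihood ν U x ≤ 2 / (d * (d + 1)) := by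
  have hd' : (0 : ℝ) < d := by exact_mod_cast hd
  have h := hν.integral_norm_cInner_sq_mul hd (fun i => U j i (x j)) (fun i => U k i (x k))
  have hle : ∫ ψ, bornP (U j) (x j) ψ * bornP (U k) (x k) ψ ∂ν ≤ 2 / (d * (d + 1)) := by
    simp only [bornP_eq_cInner, h]
    have hc := norm_cInner_sq_le (fun i => U j i (x j)) (fun i => U k i (x k))
    rw [sum_norm_sq_col (hU j), sum_norm_sq_col (hU k)] at hc ⊢
    gcongr
    linarith
  refine le_trans (integral_mono_ae
    (hν.integrable_of_continuous (continuous_prod_bornP U x))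
    (hν.integrable_of_continuous ?_) ?_) hle
  · unfold bornP
    fun_prop
  · filter_upwards [hν.ae_unit] with φ hφ
    rw [← Finset.prod_pair (f := fun i => bornP (U i) (x i) φ) hjk]
    exact Finset.prod_le_prod_of_subset_of_le_one (Finset.subset_univ _)
      (fun i _ => bornP_nonneg _ _ _) fun i _ _ => bornP_le_one (hU i) (x i) hφ

theorem measurable_integral_of_continuous [IsProbabilityMeasure ν]
    {f : (Fin N → Fin d → Fin d → ℂ) × (Fin d → ℂ) → ℝ} (hf : Continuous f) :
    Measurable fun U => ∫ φ, f (U, φ) ∂ν :=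
  hf.stronglyMeasurable.integral_prod_right'.measurable

theorem measurable_meanLikelihood [IsProbabilityMeasure ν] (x : Fin N → Fin d) :
    Measurable fun U => meanLikelihood ν U x := by
  refine measurable_integral_of_continuous
    (f := fun q => ∏ i, bornP (q.1 i) (x i) q.2) ?_
  unfold bornP
  fun_prop

theorem measurable_weightedLikelihood [IsProbabilityMeasure ν] (x : Fin N → Fin d)
    (k : Fin N) : Measurable fun U => weightedLikelihood ν U x k := by
  refine measurable_integral_of_continuous
    (f := fun q => bornP (q.1 k) (x k) q.2 * ∏ i, bornP (q.1 i) (x i) q.2) ?_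
  unfold bornP
  fun_prop

end Likelihood

theorem factorial_le_pow_mul {d n : ℕ} (hd : 0 < d) :
    2 * (n + 2 + d - 1).factorial ≤
      d ^ (n + 1) * (d + 1) * (n + 2).factorial * (d - 1).factorial := by
  obtain ⟨e, rfl⟩ : ∃ e, d = e + 1 := ⟨d - 1, by omega⟩
  induction n with
  | zero =>
    have h : 0 + 2 + (e + 1) - 1 = e + 1 + 1 := by omega
    rw [h, Nat.factorial_succ, Nat.factorial_succ]
    simp only [Nat.add_sub_cancel, Nat.factorial]
    apply le_of_eq
    ring
  | succ n ih =>
    have h : n + 1 + 2 + (e + 1) - 1 = (n + 2 + (e + 1) - 1) + 1 := by omega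
    have h3 : n + 2 + (e + 1) - 1 + 1 ≤ (e + 1) * (n + 3) := by
      have : n + 2 + (e + 1) - 1 + 1 = n + e + 3 := by omega
      rw [this]
      nlinarith [Nat.zero_le (e * n)]
    rw [h, Nat.factorial_succ (n + 2 + (e + 1) - 1), Nat.factorial_succ (n + 2)]
    calc _ = (n + 2 + (e + 1) - 1 + 1) * (2 * (n + 2 + (e + 1) - 1).factorial) := by ring
      _ ≤ ((e + 1) * (n + 3)) * _ := Nat.mul_le_mul h3 ih
      _ = _ := by ring

theorem lower_bound_le_half {d N : ℕ} (hd : 2 ≤ d) (hN : 2 ≤ N) :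
    ((d + 3) * Nat.factorial (N + d - 1) : ℝ) /
        (d ^ N * (d + 1) ^ 2 * Nat.factorial N * Nat.factorial (d - 1)) ≤ 1 / 2 := by
  obtain ⟨n, rfl⟩ : ∃ n, N = n + 2 := ⟨N - 2, by omega⟩
  have h := factorial_le_pow_mul (n := n) (show 0 < d by omega)
  have hR : (2 * (n + 2 + d - 1).factorial : ℝ) ≤
      d ^ (n + 1) * (d + 1) * (n + 2).factorial * (d - 1).factorial := by exact_mod_cast h
  have hd' : (2 : ℝ) ≤ d := by exact_mod_cast hd
  have h1 : (0 : ℝ) < (n + 2).factorial := by exact_mod_cast Nat.factorial_pos _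
  have h2 : (0 : ℝ) < (d - 1).factorial := by exact_mod_cast Nat.factorial_pos _
  rw [div_le_iff₀ (by positivity)]
  have h3 : (d + 3 : ℝ) ≤ d * (d + 1) := by nlinarith
  calc ((d + 3) * (n + 2 + d - 1).factorial : ℝ)
      = (d + 3) * (2 * (n + 2 + d - 1).factorial) / 2 := by ring
    _ ≤ (d * (d + 1)) *
        (d ^ (n + 1) * (d + 1) * (n + 2).factorial * (d - 1).factorial) / 2 := by gcongr
    _ = _ := by ring

/-- The lower bound holds for every fixed choice of measurement bases. -/
theorem lower_bound_le_sum_likelihood {d N : ℕ} (hd : 0 < d) {ν : Measure (Fin d → ℂ)}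
    (hν : IsUnitarilyInvariant ν) {U : Fin N → Fin d → Fin d → ℂ}
    (hU : ∀ i, Matrix.of (U i) ∈ Matrix.unitaryGroup (Fin d) ℂ) (k : Fin N) :
    ((d + 3) * Nat.factorial (N + d - 1) : ℝ) /
        (d ^ N * (d + 1) ^ 2 * Nat.factorial N * Nat.factorial (d - 1)) ≤
      ∑ x, (meanLikelihood ν U x)⁻¹ *
        (meanLikelihood ν U x + weightedLikelihood ν U x k) / (d * (d + 1)) := by
  have := hν.isProbabilityMeasure
  have hd' : (0 : ℝ) < d := by exact_mod_cast hd
  obtain hd2 | rfl : 2 ≤ d ∨ d = 1 := by omega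
  · obtain hN2 | rfl : 2 ≤ N ∨ N = 1 := by have := k.pos; omega
    · obtain ⟨j, hj⟩ : ∃ j : Fin N, j ≠ k := by
        have : Nontrivial (Fin N) := Fin.nontrivial_iff_two_le.mpr hN2
        exact exists_ne k
      refine (lower_bound_le_half hd2 hN2).trans ?_
      calc (1 / 2 : ℝ) = ∑ x, meanLikelihood ν U x / 2 := by
            rw [← Finset.sum_div, sum_meanLikelihood hν hU]
        _ ≤ _ := Finset.sum_le_sum fun x _ => ?_
      have hZ := meanLikelihood_nonneg (ν := ν) (U := U) x
      have hQ := weightedLikelihood_nonneg (ν := ν) (U := U) x k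
      rcases hZ.eq_or_lt with h0 | hpos
      · simp [← h0]
      · have hle := meanLikelihood_le hν hd hU x hj
        calc meanLikelihood ν U x / 2 ≤ 2 / (d * (d + 1)) / 2 := by gcongr
          _ = (meanLikelihood ν U x)⁻¹ * (meanLikelihood ν U x + 0) / (d * (d + 1)) := by
            field_simp
            ring
          _ ≤ _ := by gcongr
    · obtain rfl : k = 0 := Subsingleton.elim _ _
      have hZ : ∀ x, meanLikelihood ν U x = 1 / d := fun x => by
        simp only [meanLikelihood, Finset.univ_unique, Finset.prod_singleton, bornP_eq_cInner]
        rw [hν.integral_norm_cInner_sq, sum_norm_sq_col (hU _)]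
      have hQ : ∀ x, weightedLikelihood ν U x 0 = 2 / (d * (d + 1)) := fun x => by
        have hself : ‖cInner (fun i => U 0 i (x 0)) (fun i => U 0 i (x 0))‖ ^ 2 = 1 := by
          rw [cInner_eq_inner, inner_self_eq_norm_sq_to_K, norm_pow, RCLike.norm_ofReal, abs_norm,
            norm_toLp_sq, sum_norm_sq_col (hU 0), one_pow]
        simp only [weightedLikelihood, Finset.univ_unique, Finset.prod_singleton, bornP_eq_cInner,
          Fin.default_eq_zero]
        rw [hν.integral_norm_cInner_sq_mul hd, sum_norm_sq_col (hU 0), hself]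
        norm_num
      simp only [hZ, hQ, Finset.sum_const, Finset.card_univ, Fintype.card_pi_const, Fintype.card_fin,
        nsmul_eq_mul, Nat.factorial_one, pow_one, Nat.add_sub_cancel_left]
      have hf : (d.factorial : ℝ) = d * (d - 1).factorial := by
        exact_mod_cast (Nat.mul_factorial_pred hd.ne').symm
      have h2 : (0 : ℝ) < (d - 1).factorial := by exact_mod_cast Nat.factorial_pos _
      rw [hf]
      apply le_of_eq
      field_simp
      push_cast
      ring
  · have hp : ∀ᵐ φ ∂ν, ∀ i x, bornP (U i) x φ = 1 := by
      filter_upwards [hν.ae_unit] with φ hφ i x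
      have h := sum_bornP (hU i) φ
      rw [hφ, Fin.sum_univ_one] at h
      rwa [Subsingleton.elim x 0]
    have hZ : ∀ x, meanLikelihood ν U x = 1 := fun x => by
      rw [meanLikelihood, integral_congr_ae (g := fun _ => (1 : ℝ)) (by
        filter_upwards [hp] with φ hφ
        simp [hφ])]
      simp
    have hQ : ∀ x, weightedLikelihood ν U x k = 1 := fun x => by
      rw [weightedLikelihood, integral_congr_ae (g := fun _ => (1 : ℝ)) (by
        filter_upwards [hp] with φ hφ
        simp [hφ])]
      simp
    have h2 : (0 : ℝ) < N.factorial := by exact_mod_cast Nat.factorial_pos _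
    simp only [hZ, hQ]
    simp
    rw [div_le_iff₀ (by positivity)]
    apply le_of_eq
    ring

/-- Bayesian mean estimation with `N` Haar-random measurement bases for pure
states under fidelity: the Haar-averaged posterior-mean fidelity, averaged over
an IID sequence of `N` Haar-random bases and over the Haar ensemble of pure
states, is at least `(d+3)(N+d−1)! / (dᴺ (d+1)² N! (d−1)!)`; equivalently, the
average risk measured in infidelity is at most
`1 − (d+3)(N+d−1)!/(dᴺ (d+1)² N! (d−1)!)`. -/
theorem average_fidelity_N_haar_bases_lower_bound {d N : ℕ} (hd : 0 < d)
    (hN : 0 < N) (μU : Measure (Fin d → Fin d → ℂ)) (hμU : IsHaarUnitary μU) :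
    ((d + 3) * Nat.factorial (N + d - 1) : ℝ) /
        (d ^ N * (d + 1) ^ 2 * Nat.factorial N * Nat.factorial (d - 1)) ≤
      ∫ U : Fin N → Fin d → Fin d → ℂ,
        ∑ x : Fin N → Fin d,
          ∫ ψ,
            bornP (U ⟨N - 1, Nat.sub_lt hN Nat.one_pos⟩)
                (x ⟨N - 1, Nat.sub_lt hN Nat.one_pos⟩) ψ *
              (bayesZ hd μU U x)⁻¹ *
              (∫ φ, ‖cInner ψ φ‖ ^ 2 * ∏ i, bornP (U i) (x i) φ
                ∂(pureStateMeasure hd μU))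
            ∂(pureStateMeasure hd μU)
        ∂(Measure.pi fun _ : Fin N => μU) := by
  have := hμU.1
  have hν := isUnitarilyInvariant_pureStateMeasure hd hμU
  set ν := pureStateMeasure hd μU with hν_def
  have := hν.isProbabilityMeasure
  set k : Fin N := ⟨N - 1, Nat.sub_lt hN Nat.one_pos⟩
  have hd' : (0 : ℝ) < d := by exact_mod_cast hd
  have hUae : ∀ᵐ U ∂(Measure.pi fun _ : Fin N => μU),
      ∀ i, Matrix.of (U i) ∈ Matrix.unitaryGroup (Fin d) ℂ :=
    ae_all_iff.mpr fun i =>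
      (measurePreserving_eval (fun _ : Fin N => μU) i).quasiMeasurePreserving.ae hμU.2.1
  have hint : Integrable (fun U => ∑ x, (meanLikelihood ν U x)⁻¹ *
      (meanLikelihood ν U x + weightedLikelihood ν U x k) / (d * (d + 1)))
      (Measure.pi fun _ : Fin N => μU) := by
    refine integrable_finsetSum _ fun x _ => ?_
    have hm1 := measurable_meanLikelihood (ν := ν) x
    have hm2 := measurable_weightedLikelihood (ν := ν) x k
    refine Integrable.of_bound (C := 2 / (d * (d + 1)))
      (Measurable.aestronglyMeasurable (by fun_prop)) ?_
    filter_upwards [hUae] with U hU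
    have hZ := meanLikelihood_nonneg (ν := ν) (U := U) x
    have hQ := weightedLikelihood_nonneg (ν := ν) (U := U) x k
    have hle := weightedLikelihood_le hν hU x k
    rw [Real.norm_of_nonneg (by positivity)]
    gcongr
    rcases hZ.eq_or_lt with h0 | hpos
    · simp [← h0]
    · rw [inv_mul_le_iff₀ hpos]
      linarith
  have hcongr : (fun U : Fin N → Fin d → Fin d → ℂ => ∑ x : Fin N → Fin d,
        ∫ ψ, bornP (U k) (x k) ψ * (bayesZ hd μU U x)⁻¹ *
          (∫ φ, ‖cInner ψ φ‖ ^ 2 * ∏ i, bornP (U i) (x i) φ ∂ν) ∂ν)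
      =ᵐ[Measure.pi fun _ : Fin N => μU] fun U => ∑ x, (meanLikelihood ν U x)⁻¹ *
        (meanLikelihood ν U x + weightedLikelihood ν U x k) / (d * (d + 1)) := by
    filter_upwards [hUae] with U hU
    exact Finset.sum_congr rfl fun x _ =>
      hν.integral_norm_cInner_sq_mul_integral hd (sum_norm_sq_col (hU k) (x k)) _
        (continuous_prod_bornP U x)
  rw [integral_congr_ae hcongr]
  have hmono := integral_mono_ae (integrable_const _) hint
    (by filter_upwards [hUae] with U hU using lower_bound_le_sum_likelihood hd hν hU k)
  simpa using hmono
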